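/- (Axiomatization of weakly memorizing valuation congruence) For all propositional statements P and Q: CP_wm ⊢ P = Q if and only if P =_wm Q, where CP_wm is CP_cr (CP plus (x◁a▷y)◁a▷z = x◁a▷z and x◁a▷(y◁a▷z) = x◁a▷z for all a ∈ A) extended with the axiom schemes (CPwm1) ((x◁a▷y)◁b▷z)◁a▷v = (x◁b▷z)◁a▷v and (CPwm2) x◁a▷(y◁b▷(z◁a▷v)) = x◁a▷(y◁b▷v) for all a, b ∈ A. -/

import Mathlib

/-- Propositional statements over atoms `A`: constants `T`, `F`, an atom `a`
for each `a ∈ A`, and the ternary conditional composition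
`cond x y z = x ◁ y ▷ z` (with `y` the central condition). -/
inductive PS (A : Type) : Type where
  | tt : PS A
  | ff : PS A
  | atom : A → PS A
  | cond : PS A → PS A → PS A → PS A

/-- A valuation algebra (VA) over `A`. -/
structure VA (A : Type) where
  Val : Type
  Tv : Val
  Fv : Val
  yd : A → Val → Bool
  dv : A → Val → Val
  yd_T : ∀ a, yd a Tv = true
  yd_F : ∀ a, yd a Fv = false
  dv_T : ∀ a, dv a Tv = Tv
  dv_F : ∀ a, dv a Fv = Fv

variable {A : Type}

mutual
  /-- Evaluation `P/H` of a propositional statement over a valuation `H`. -/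
  def PS.eval (V : VA A) : PS A → V.Val → Bool
    | .tt, _ => true
    | .ff, _ => false
    | .atom a, H => V.yd a H
    | .cond p q r, H =>
        if PS.eval V q H then PS.eval V p (PS.deriv V q H)
        else PS.eval V r (PS.deriv V q H)
  /-- The generalized derivative `∂_P(H)`. -/
  def PS.deriv (V : VA A) : PS A → V.Val → V.Val
    | .tt, H => H
    | .ff, H => H
    | .atom a, H => V.dv a H
    | .cond p q r, H =>
        if PS.eval V q H then PS.deriv V p (PS.deriv V q H)
        else PS.deriv V r (PS.deriv V q H)
end

/-- `K`-equivalence: equal evaluation results in all members of the class `K`. -/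
def KEquiv (K : VA A → Prop) (P Q : PS A) : Prop :=
  ∀ V : VA A, K V → ∀ H : V.Val, PS.eval V P H = PS.eval V Q H

/-- A congruence with respect to conditional composition. -/
def IsCondCongruence (R : PS A → PS A → Prop) : Prop :=
  Equivalence R ∧
    ∀ ⦃x x' y y' z z' : PS A⦄, R x x' → R y y' → R z z' →
      R (PS.cond x y z) (PS.cond x' y' z')

/-- `K`-congruence: the largest congruence contained in `K`-equivalence. -/
def KCong (K : VA A → Prop) (P Q : PS A) : Prop :=
  ∃ R : PS A → PS A → Prop,
    IsCondCongruence R ∧ (∀ x y, R x y → KEquiv K x y) ∧ R P Q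

/-- Derivability (of closed equations) in equational logic from the axioms `CP`
together with an additional set `Ax` of equational axioms. -/
inductive Deriv (Ax : PS A → PS A → Prop) : PS A → PS A → Prop where
  | ax {p q} : Ax p q → Deriv Ax p q
  | cp1 (x y) : Deriv Ax (.cond x .tt y) x
  | cp2 (x y) : Deriv Ax (.cond x .ff y) y
  | cp3 (x) : Deriv Ax (.cond .tt x .ff) x
  | cp4 (x y z u v) :
      Deriv Ax (.cond x (.cond y z u) v)
               (.cond (.cond x y v) z (.cond x u v))
  | refl (x) : Deriv Ax x x
  | symm {p q} : Deriv Ax p q → Deriv Ax q p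
  | trans {p q r} : Deriv Ax p q → Deriv Ax q r → Deriv Ax p r
  | congr {x x' y y' z z'} : Deriv Ax x x' → Deriv Ax y y' → Deriv Ax z z' →
      Deriv Ax (.cond x y z) (.cond x' y' z')

/-- No additional axioms: plain `CP`. -/
def NoAx : PS A → PS A → Prop := fun _ _ => False

/-- The class `fr` of free valuation algebras: all VAs. -/
def frK : VA A → Prop := fun _ => True

/-- The class `rp` of repetition-proof VAs. -/
def rpK (V : VA A) : Prop :=
  ∀ (a : A) (x : V.Val), V.yd a x = V.yd a (V.dv a x)

/-- The class `cr` of contractive VAs. -/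
def crK (V : VA A) : Prop :=
  rpK V ∧ ∀ (a : A) (x : V.Val), V.dv a (V.dv a x) = V.dv a x

/-- The class `wm` of weakly memorizing VAs. -/
def wmK (V : VA A) : Prop :=
  crK V ∧ ∀ (a b : A) (x : V.Val),
    V.yd b (V.dv a x) = V.yd a x →
      V.dv a (V.dv b (V.dv a x)) = V.dv b (V.dv a x) ∧
      V.yd a (V.dv b (V.dv a x)) = V.yd a x

/-- The class `mem` of memorizing VAs. -/
def memK (V : VA A) : Prop :=
  crK V ∧ ∀ (a b : A) (x : V.Val),
    V.dv a (V.dv b (V.dv a x)) = V.dv b (V.dv a x) ∧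
    V.yd a (V.dv b (V.dv a x)) = V.yd a x

/-- The class `st` of static VAs. -/
def stK (V : VA A) : Prop :=
  ∀ (a b : A) (x : V.Val), V.yd a (V.dv b x) = V.yd a x

/-- The axiom schemes of `CP_wm` beyond `CP`: `(CPcr1)`, `(CPcr2)`,
`(CPwm1)` and `(CPwm2)` (for `a, b ∈ A`). -/
inductive WmAx {A : Type} : PS A → PS A → Prop where
  | cr1 (a : A) (x y z : PS A) :
      WmAx (.cond (.cond x (.atom a) y) (.atom a) z)
           (.cond x (.atom a) z)
  | cr2 (a : A) (x y z : PS A) :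
      WmAx (.cond x (.atom a) (.cond y (.atom a) z))
           (.cond x (.atom a) z)
  | wm1 (a b : A) (x y z v : PS A) :
      WmAx (.cond (.cond (.cond x (.atom a) y) (.atom b) z) (.atom a) v)
           (.cond (.cond x (.atom b) z) (.atom a) v)
  | wm2 (a b : A) (x y z v : PS A) :
      WmAx (.cond x (.atom a) (.cond y (.atom b) (.cond z (.atom a) v)))
           (.cond x (.atom a) (.cond y (.atom b) v))

/-! ### Soundness -/

theorem WmAx.sound {p q : PS A} (h : WmAx p q) (V : VA A) (hV : wmK V) (H : V.Val) :
    p.eval V H = q.eval V H ∧ p.deriv V H = q.deriv V H := by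
  obtain ⟨⟨hrp, hcr⟩, hwm⟩ := hV
  cases h with
  | cr1 a x y z | cr2 a x y z =>
    have h₁ := hrp a H
    have h₂ := hcr a H
    cases e : V.yd a H <;> simp_all [PS.eval, PS.deriv]
  | wm1 a b x y z v | wm2 a b x y z v =>
    have h₁ := hwm a b H
    cases e : V.yd a H <;> cases e' : V.yd b (V.dv a H) <;> simp_all [PS.eval, PS.deriv]

theorem Deriv.sound {p q : PS A} (h : Deriv WmAx p q) (V : VA A) (hV : wmK V) :
    ∀ H : V.Val, p.eval V H = q.eval V H ∧ p.deriv V H = q.deriv V H := by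
  induction h with
  | ax h => exact h.sound V hV
  | cp1 | cp2 => simp [PS.eval, PS.deriv]
  | cp3 x => intro H; cases e : x.eval V H <;> simp [PS.eval, PS.deriv, e]
  | cp4 x y z u v =>
    intro H
    cases e : z.eval V H <;> simp [PS.eval, PS.deriv, e]
  | refl => simp
  | symm _ ih => exact fun H => ⟨(ih H).1.symm, (ih H).2.symm⟩
  | trans _ _ ih₁ ih₂ =>
    exact fun H => ⟨(ih₁ H).1.trans (ih₂ H).1, (ih₁ H).2.trans (ih₂ H).2⟩
  | congr _ _ _ ih₁ ih₂ ih₃ =>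
    intro H
    simp only [PS.eval, PS.deriv, (ih₂ H).1, (ih₂ H).2, fun H => (ih₁ H).1, fun H => (ih₁ H).2,
      fun H => (ih₃ H).1, fun H => (ih₃ H).2, and_self]

theorem Deriv.kCong {p q : PS A} (h : Deriv WmAx p q) : KCong wmK p q :=
  ⟨Deriv WmAx, ⟨⟨.refl, .symm, .trans⟩, fun _ _ _ _ _ _ => .congr⟩,
    fun _ _ h V hV H => (h.sound V hV H).1, h⟩

theorem KCong.eval_eq {K : VA A → Prop} {p q : PS A} (h : KCong K p q) {V : VA A} (hV : K V)
    (H : V.Val) : p.eval V H = q.eval V H := by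
  obtain ⟨R, -, hK, h⟩ := h
  exact hK _ _ h V hV H

theorem KCong.yd_deriv_eq {K : VA A → Prop} {p q : PS A} (h : KCong K p q) {V : VA A} (hV : K V)
    (H : V.Val) (c : A) : V.yd c (p.deriv V H) = V.yd c (q.deriv V H) := by
  obtain ⟨R, hR, hK, h⟩ := h
  have := hK _ _ (hR.2 (hR.1.refl (.atom c)) h (hR.1.refl (.atom c))) V hV H
  simpa [PS.eval] using this

/-! ### Basic forms -/

/-- Basic forms: binary decision trees over the atoms. -/
inductive BasicForm (A : Type) : Type where
  | leaf : Bool → BasicForm A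
  | node : A → BasicForm A → BasicForm A → BasicForm A

namespace BasicForm

/-- The propositional statement denoted by a basic form. -/
def toPS : BasicForm A → PS A
  | leaf true => .tt
  | leaf false => .ff
  | node a l r => .cond l.toPS (.atom a) r.toPS

/-- Replace the leaves `T` and `F` by the given basic forms. -/
def graft (x z : BasicForm A) : BasicForm A → BasicForm A
  | leaf true => x
  | leaf false => z
  | node a l r => node a (graft x z l) (graft x z r)

/-- The basic form of a propositional statement. -/
def ofPS : PS A → BasicForm A
  | .tt => leaf true
  | .ff => leaf false
  | .atom a => node a (leaf true) (leaf false)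
  | .cond p q r => graft (ofPS p) (ofPS r) (ofPS q)

theorem deriv_graft {Ax : PS A → PS A → Prop} (x z t : BasicForm A) :
    Deriv Ax (.cond x.toPS t.toPS z.toPS) (graft x z t).toPS := by
  induction t with
  | leaf b =>
    cases b
    · exact .cp2 _ _
    · exact .cp1 _ _
  | node a l r ihl ihr => exact (Deriv.cp4 ..).trans (.congr ihl (.refl _) ihr)

theorem deriv_ofPS {Ax : PS A → PS A → Prop} (p : PS A) : Deriv Ax p (ofPS p).toPS := by
  induction p with
  | tt | ff => exact .refl _
  | atom a => exact (Deriv.cp3 _).symm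
  | cond p q r ihp ihq ihr => exact (Deriv.congr ihp ihq ihr).trans (deriv_graft ..)

end BasicForm

/-! ### Runs of equal replies -/

/-- The set of atoms remembered after atom `a` has received reply `w`, when the atoms in `S` were
remembered with reply `v`. -/
def extendRun (v : Bool) (S : Set A) (a : A) (w : Bool) : Set A :=
  {c | c = a ∨ (w = v ∧ c ∈ S)}

theorem mem_extendRun_self (v : Bool) (S : Set A) (a : A) (w : Bool) : a ∈ extendRun v S a w :=
  Or.inl rfl

/-- Branching on `a`, continuing with `x` on reply `w` and with `y` on the other reply. -/
def PS.branch (w : Bool) (x : PS A) (a : A) (y : PS A) : PS A :=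
  if w then .cond x (.atom a) y else .cond y (.atom a) x

theorem Deriv.branch {Ax : PS A → PS A → Prop} {x x' y y' : PS A} (w : Bool) (a : A)
    (hx : Deriv Ax x x') (hy : Deriv Ax y y') :
    Deriv Ax (PS.branch w x a y) (PS.branch w x' a y') := by
  cases w
  · exact .congr hy (.refl _) hx
  · exact .congr hx (.refl _) hy

theorem deriv_branch_branch (w : Bool) (a : A) (x y z : PS A) :
    Deriv WmAx (.branch w (.branch w x a y) a z) (.branch w x a z) := by
  cases w
  · exact .ax (.cr2 ..)
  · exact .ax (.cr1 ..)

theorem deriv_branch_branch_branch (w : Bool) (a b : A) (x y z u : PS A) :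
    Deriv WmAx (.branch w (.branch w (.branch w x a y) b z) a u)
      (.branch w (.branch w x b z) a u) := by
  cases w
  · exact .ax (.wm2 ..)
  · exact .ax (.wm1 ..)

/-- A context in which each atom of `S` is remembered with reply `v`. -/
structure IsRunContext (v : Bool) (S : Set A) (C : PS A → PS A) : Prop where
  congr : ∀ {x y}, Deriv WmAx x y → Deriv WmAx (C x) (C y)
  branch : ∀ {a}, a ∈ S → ∀ x y, Deriv WmAx (C (.branch v x a y)) (C x)

theorem IsRunContext.extend {v : Bool} {S : Set A} {C : PS A → PS A} (hC : IsRunContext v S C)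
    (a : A) (w : Bool) (z : PS A) :
    IsRunContext w (extendRun v S a w) (fun x => C (.branch w x a z)) where
  congr h := hC.congr (h.branch w a (.refl _))
  branch := by
    rintro b (rfl | ⟨rfl, hb⟩) x y
    · exact hC.congr (deriv_branch_branch ..)
    · exact (hC.branch hb _ z).symm.trans
        ((hC.congr (deriv_branch_branch_branch ..)).trans (hC.branch hb _ z))

/-! ### Reduced basic forms -/

namespace BasicForm

/-- No atom is asked while it is remembered. -/
def Reduced : Bool → Set A → BasicForm A → Prop
  | _, _, leaf _ => True
  | v, S, node a l r =>
    a ∉ S ∧ l.Reduced true (extendRun v S a true) ∧ r.Reduced false (extendRun v S a false)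

theorem exists_reduced (t : BasicForm A) : ∀ (v : Bool) (S : Set A), ∃ u : BasicForm A,
    u.Reduced v S ∧ ∀ C, IsRunContext v S C → Deriv WmAx (C t.toPS) (C u.toPS) := by
  induction t with
  | leaf b => exact fun v S => ⟨leaf b, trivial, fun C _ => .refl _⟩
  | node a l r ihl ihr =>
    intro v S
    by_cases ha : a ∈ S
    · cases v
      · obtain ⟨u, hu, h⟩ := ihr false S
        exact ⟨u, hu, fun C hC => (hC.branch ha _ _).trans (h C hC)⟩
      · obtain ⟨u, hu, h⟩ := ihl true S
        exact ⟨u, hu, fun C hC => (hC.branch ha _ _).trans (h C hC)⟩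
    · obtain ⟨l', hl', hl⟩ := ihl true (extendRun v S a true)
      obtain ⟨r', hr', hr⟩ := ihr false (extendRun v S a false)
      exact ⟨node a l' r', ⟨ha, hl', hr'⟩, fun C hC =>
        (hl _ (hC.extend a true r.toPS)).trans (hr _ (hC.extend a false l'.toPS))⟩

end BasicForm

/-! ### The valuation algebra of oracles -/

/-- Valuations of the oracle algebra: the atoms in `memory` are remembered with reply `value`, and
the reply to any other atom is given by `oracle`, depending on the new atoms asked before. -/
structure OracleState (A : Type) : Type where
  value : Bool
  memory : Set A
  oracle : List A → A → Bool

open Classical in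
/-- The weakly memorizing valuation algebra of all oracles. -/
noncomputable abbrev oracleVA (A : Type) : VA A where
  Val := OracleState A
  Tv := ⟨true, Set.univ, fun _ _ => true⟩
  Fv := ⟨false, Set.univ, fun _ _ => false⟩
  yd a H := if a ∈ H.memory then H.value else H.oracle [] a
  dv a H := if a ∈ H.memory then H else
    ⟨H.oracle [] a, extendRun H.value H.memory a (H.oracle [] a), fun s => H.oracle (a :: s)⟩
  yd_T := by simp
  yd_F := by simp
  dv_T := by simp
  dv_F := by simp

theorem oracleVA_yd_of_mem {a : A} {H : OracleState A} (h : a ∈ H.memory) :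
    (oracleVA A).yd a H = H.value := if_pos h

theorem oracleVA_yd_of_notMem {a : A} {H : OracleState A} (h : a ∉ H.memory) :
    (oracleVA A).yd a H = H.oracle [] a := if_neg h

theorem oracleVA_dv_of_mem {a : A} {H : OracleState A} (h : a ∈ H.memory) :
    (oracleVA A).dv a H = H := if_pos h

theorem oracleVA_dv_of_notMem {a : A} {H : OracleState A} (h : a ∉ H.memory) :
    (oracleVA A).dv a H = ⟨H.oracle [] a, extendRun H.value H.memory a (H.oracle [] a),
      fun s => H.oracle (a :: s)⟩ := if_neg h

theorem oracleVA_mem_dv (a : A) (H : OracleState A) :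
    a ∈ ((oracleVA A).dv a H : OracleState A).memory := by
  by_cases h : a ∈ H.memory
  · rwa [oracleVA_dv_of_mem h]
  · rw [oracleVA_dv_of_notMem h]
    exact mem_extendRun_self ..

theorem oracleVA_value_dv (a : A) (H : OracleState A) :
    ((oracleVA A).dv a H : OracleState A).value = (oracleVA A).yd a H := by
  by_cases h : a ∈ H.memory
  · rw [oracleVA_dv_of_mem h, oracleVA_yd_of_mem h]
  · rw [oracleVA_dv_of_notMem h, oracleVA_yd_of_notMem h]

theorem oracleVA_mem_dv_of_mem {a b : A} {H : OracleState A} (ha : a ∈ H.memory)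
    (hb : (oracleVA A).yd b H = H.value) :
    a ∈ ((oracleVA A).dv b H : OracleState A).memory := by
  by_cases h : b ∈ H.memory
  · rwa [oracleVA_dv_of_mem h]
  · rw [oracleVA_yd_of_notMem h] at hb
    rw [oracleVA_dv_of_notMem h]
    exact Or.inr ⟨hb, ha⟩

theorem oracleVA_wmK (A : Type) : wmK (oracleVA A) := by
  refine ⟨⟨fun a H => ?_, fun a H => oracleVA_dv_of_mem (oracleVA_mem_dv a H)⟩, fun a b H h => ?_⟩
  · exact ((oracleVA_yd_of_mem (oracleVA_mem_dv a H)).trans (oracleVA_value_dv a H)).symm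
  · have hm := oracleVA_mem_dv_of_mem (b := b) (oracleVA_mem_dv a H)
      (h.trans (oracleVA_value_dv a H).symm)
    refine ⟨oracleVA_dv_of_mem hm, ?_⟩
    rw [oracleVA_yd_of_mem hm, oracleVA_value_dv, h]

/-- The valuation that always replies `w`. -/
def OracleState.const (w : Bool) (S : Set A) : OracleState A := ⟨w, S, fun _ _ => w⟩

theorem oracleVA_yd_const (w : Bool) (S : Set A) (c : A) :
    (oracleVA A).yd c (OracleState.const w S) = w := ite_self _

theorem oracleVA_deriv_const (p : PS A) (w : Bool) :
    ∀ S, ∃ S', p.deriv (oracleVA A) (OracleState.const w S) = OracleState.const w S' := by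
  induction p with
  | tt | ff => exact fun S => ⟨S, rfl⟩
  | atom a =>
    intro S
    by_cases h : a ∈ S
    · exact ⟨S, oracleVA_dv_of_mem h⟩
    · exact ⟨_, oracleVA_dv_of_notMem h⟩
  | cond p q r ihp ihq ihr =>
    intro S
    obtain ⟨S', hq⟩ := ihq S
    simp only [PS.deriv, hq]
    split
    · exact ihp S'
    · exact ihr S'

theorem oracleVA_yd_deriv_const (p : PS A) (w : Bool) (S : Set A) (c : A) :
    (oracleVA A).yd c (p.deriv (oracleVA A) (OracleState.const w S)) = w := by
  obtain ⟨S', h⟩ := oracleVA_deriv_const p w S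
  rw [h, oracleVA_yd_const]

/-! ### Separation of reduced basic forms -/

namespace BasicForm

theorem eval_node (V : VA A) (a : A) (l r : BasicForm A) (H : V.Val) :
    (node a l r).toPS.eval V H = (if V.yd a H then l else r).toPS.eval V (V.dv a H) := by
  cases h : V.yd a H <;> simp [toPS, PS.eval, PS.deriv, h]

theorem deriv_node (V : VA A) (a : A) (l r : BasicForm A) (H : V.Val) :
    (node a l r).toPS.deriv V H = (if V.yd a H then l else r).toPS.deriv V (V.dv a H) := by
  cases h : V.yd a H <;> simp [toPS, PS.eval, PS.deriv, h]

theorem deriv_leaf (V : VA A) (b : Bool) (H : V.Val) : (leaf b).toPS.deriv V H = H := by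
  cases b <;> rfl

/-- The valuation `H` tells `p` and `q` apart, by their value or by a later reply. -/
def Separates (H : OracleState A) (p q : BasicForm A) : Prop :=
  p.toPS.eval (oracleVA A) H ≠ q.toPS.eval (oracleVA A) H ∨
    ∃ c, (oracleVA A).yd c (p.toPS.deriv (oracleVA A) H) ≠
      (oracleVA A).yd c (q.toPS.deriv (oracleVA A) H)

theorem Separates.symm {H : OracleState A} {p q : BasicForm A} (h : Separates H p q) :
    Separates H q p :=
  h.imp Ne.symm fun ⟨c, hc⟩ => ⟨c, hc.symm⟩

theorem yd_deriv_node_of_const {v w : Bool} {S : Set A} {g : List A → A → Bool} {a : A}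
    (ha : a ∉ S) (h : g [] a = w) (hg : ∀ s x, g (a :: s) x = w) (l r : BasicForm A) (c : A) :
    (oracleVA A).yd c ((node a l r).toPS.deriv (oracleVA A) (⟨v, S, g⟩ : OracleState A)) = w := by
  have hd : (oracleVA A).dv a (⟨v, S, g⟩ : OracleState A) =
      OracleState.const w (extendRun v S a w) := by
    rw [oracleVA_dv_of_notMem ha]
    simp only [OracleState.const, h, funext fun s => funext (hg s)]
  rw [deriv_node, hd, oracleVA_yd_deriv_const]

open Classical in
theorem exists_separates_node_leaf [Nontrivial A] {v : Bool} {S : Set A} {a : A} (ha : a ∉ S)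
    (l r : BasicForm A) (b : Bool) :
    ∃ g, Separates ⟨v, S, g⟩ (node a l r) (leaf b) := by
  obtain ⟨c, hc⟩ := exists_ne a
  refine ⟨fun s x => if s = [] ∧ x ≠ a then v else !v, Or.inr ⟨c, ?_⟩⟩
  rw [yd_deriv_node_of_const (w := !v) ha (by simp) (by simp), deriv_leaf]
  by_cases h : c ∈ S
  · rw [oracleVA_yd_of_mem h]
    simp
  · rw [oracleVA_yd_of_notMem h]
    simp [hc]

open Classical in
theorem exists_separates_node_node_of_ne {v : Bool} {S : Set A} {a b : A} (ha : a ∉ S)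
    (hb : b ∉ S) (hab : a ≠ b) (l r l' r' : BasicForm A) :
    ∃ g, Separates ⟨v, S, g⟩ (node a l r) (node b l' r') := by
  refine ⟨fun s x => decide (s.headD x = a), Or.inr ⟨a, ?_⟩⟩
  rw [yd_deriv_node_of_const (w := true) ha (by simp) (by simp),
    yd_deriv_node_of_const (w := false) hb (by simp [hab.symm]) (by simp [hab.symm])]
  simp

theorem exists_separates_node_node_self {v w : Bool} {S : Set A} {a : A} (ha : a ∉ S)
    {l r l' r' : BasicForm A}
    (h : ∃ g, Separates ⟨w, extendRun v S a w, g⟩ (if w then l else r) (if w then l' else r')) :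
    ∃ g, Separates ⟨v, S, g⟩ (node a l r) (node a l' r') := by
  obtain ⟨g, hg⟩ := h
  let H : OracleState A := ⟨v, S, fun s => s.casesOn (fun _ => w) fun _ s => g s⟩
  have hH (l r : BasicForm A) :
      (node a l r).toPS.eval (oracleVA A) H = (if w then l else r).toPS.eval (oracleVA A)
        (⟨w, extendRun v S a w, g⟩ : OracleState A) ∧
      (node a l r).toPS.deriv (oracleVA A) H = (if w then l else r).toPS.deriv (oracleVA A)
        (⟨w, extendRun v S a w, g⟩ : OracleState A) := by
    rw [eval_node, deriv_node, oracleVA_yd_of_notMem ha, oracleVA_dv_of_notMem ha]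
    exact ⟨rfl, rfl⟩
  refine ⟨H.oracle, ?_⟩
  change Separates H _ _
  unfold Separates
  rw [(hH l r).1, (hH l r).2, (hH l' r').1, (hH l' r').2]
  exact hg

theorem exists_separates [Nontrivial A] (t : BasicForm A) : ∀ (u : BasicForm A) (v : Bool)
    (S : Set A), t.Reduced v S → u.Reduced v S → t ≠ u → ∃ g, Separates ⟨v, S, g⟩ t u := by
  induction t with
  | leaf b =>
    rintro (b' | ⟨a, l, r⟩) v S ht hu hne
    · refine ⟨fun _ _ => true, Or.inl ?_⟩
      cases b <;> cases b' <;> simp_all [toPS, PS.eval]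
    · obtain ⟨g, hg⟩ := exists_separates_node_leaf hu.1 l r b
      exact ⟨g, hg.symm⟩
  | node a l r ihl ihr =>
    rintro (b | ⟨b, l', r'⟩) v S ht hu hne
    · exact exists_separates_node_leaf ht.1 l r b
    · by_cases hab : a = b
      · subst hab
        by_cases hl : l = l'
        · have hr : r ≠ r' := fun hr => hne (by rw [hl, hr])
          exact exists_separates_node_node_self (w := false) ht.1
            (ihr r' _ _ ht.2.2 hu.2.2 hr)
        · exact exists_separates_node_node_self (w := true) ht.1
            (ihl l' _ _ ht.2.1 hu.2.1 hl)
      · exact exists_separates_node_node_of_ne ht.1 hu.1 hab l r l' r'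

end BasicForm

theorem PS.exists_reduced (p : PS A) :
    ∃ t : BasicForm A, t.Reduced true ∅ ∧ Deriv WmAx p t.toPS := by
  obtain ⟨t, ht, h⟩ := (BasicForm.ofPS p).exists_reduced true ∅
  exact ⟨t, ht, (BasicForm.deriv_ofPS p).trans (h id ⟨id, fun h => h.elim⟩)⟩

theorem KCong.deriv [Nontrivial A] {p q : PS A} (h : KCong wmK p q) : Deriv WmAx p q := by
  obtain ⟨t, ht, hpt⟩ := p.exists_reduced
  obtain ⟨u, hu, hqu⟩ := q.exists_reduced
  suffices t = u from hpt.trans (this ▸ hqu.symm)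
  by_contra hne
  obtain ⟨g, hg⟩ := t.exists_separates u true ∅ ht hu hne
  have hV := oracleVA_wmK A
  have hp := hpt.sound _ hV ⟨true, ∅, g⟩
  have hq := hqu.sound _ hV ⟨true, ∅, g⟩
  rcases hg with hg | ⟨c, hc⟩
  · exact hg (hp.1.symm.trans ((h.eval_eq hV _).trans hq.1))
  · rw [← hp.2, ← hq.2] at hc
    exact hc (h.yd_deriv_eq hV _ c)

/-- **Axiomatization of weakly memorizing valuation congruence**:
`CP_wm ⊢ P = Q` if and only if `P =_wm Q`. -/
theorem cp_wm_axiomatization {A : Type} [Countable A] [Nontrivial A]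
    (P Q : PS A) : Deriv WmAx P Q ↔ KCong wmK P Q :=
  ⟨Deriv.kCong, KCong.deriv⟩
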